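/- arXiv:2104.04618 — 2 statements merged into one kernel-verified Lean document; each statement's English description precedes it below -/
import Mathlib

section
/- Let X be a nontrivial complex Banach space and let r > 0 be a real number. The continuous linear operator M₀' on X × X defined by M₀' (v, w) = ((1/2) • v + w, -(r/4) • v + (1/2) • w) has spectrum exactly {1/2 + (i/2)·√r, 1/2 - (i/2)·√r}, where √r denotes the real square root of r and i the imaginary unit. (These are the eigenvalue accumulation points 1/2 ± (i/2)·√(ρ₋/ρ₊) of the high-contrast Dirichlet formulation with density ratio r = ρ₋/ρ₊.) -/
/-- If `a` is a root of a monic quadratic polynomial, any scalar that is not a root of that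
polynomial lies outside the spectrum of `a`. -/
theorem eq_zero_of_mem_spectrum_of_mul_self_eq {𝕜 A : Type*} [Field 𝕜] [Ring A] [Algebra 𝕜 A]
    {a : A} {p q : 𝕜} (ha : a * a = p • a + q • 1) {z : 𝕜} (hz : z ∈ spectrum 𝕜 a) :
    z * z - p * z - q = 0 := by
  by_contra hc
  refine hz ?_
  set c := z * z - p * z - q with hc_def
  have hl : (algebraMap 𝕜 A z - a) * ((z - p) • 1 + a) = c • 1 := by
    simp only [Algebra.algebraMap_eq_smul_one, sub_mul, mul_add, smul_mul_assoc, mul_smul_comm,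
      one_mul, mul_one, ha, hc_def]
    module
  have hr : ((z - p) • 1 + a) * (algebraMap 𝕜 A z - a) = c • 1 := by
    simp only [Algebra.algebraMap_eq_smul_one, mul_sub, add_mul, smul_mul_assoc, mul_smul_comm,
      one_mul, mul_one, ha, hc_def]
    module
  refine ⟨⟨algebraMap 𝕜 A z - a, c⁻¹ • ((z - p) • 1 + a), ?_, ?_⟩, rfl⟩
  · rw [mul_smul_comm, hl, inv_smul_smul₀ hc]
  · rw [smul_mul_assoc, hr, inv_smul_smul₀ hc]

/-- An eigenvalue of a continuous linear endomorphism belongs to its spectrum. -/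
theorem ContinuousLinearMap.mem_spectrum_of_apply_eq_smul {𝕜 E : Type*} [NormedField 𝕜]
    [NormedAddCommGroup E] [NormedSpace 𝕜 E] {T : E →L[𝕜] E} {z : 𝕜} {x : E} (hx : x ≠ 0)
    (h : T x = z • x) : z ∈ spectrum 𝕜 T := by
  rintro ⟨u, hu⟩
  apply hx
  have hux : (u : E →L[𝕜] E) x = 0 := by
    simp [hu, Algebra.algebraMap_eq_smul_one, h]
  have hinv : ((↑u⁻¹ : E →L[𝕜] E) * (u : E →L[𝕜] E)) x = x := by
    rw [Units.inv_mul, one_apply_eq_self]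
  rw [← hinv, mul_apply_eq_comp, hux, map_zero]

/-- For a nontrivial complex Banach space `X` and `r > 0`, the idealized
Dirichlet skeleton operator `M₀' (v, w) = ((1/2) • v + w, -(r/4) • v + (1/2) • w)` on `X × X`
has spectrum exactly `{1/2 + (i/2)·√r, 1/2 - (i/2)·√r}`. -/
theorem dirichlet_idealized_spectrum {X : Type*} [NormedAddCommGroup X] [NormedSpace ℂ X]
    [CompleteSpace X] [Nontrivial X] (r : ℝ) (hr : 0 < r)
    (M₀' : (X × X) →L[ℂ] (X × X))
    (hM₀' : ∀ v w : X, M₀' (v, w) = ((1/2 : ℂ) • v + w, -((r : ℂ)/4) • v + (1/2 : ℂ) • w)) :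
    spectrum ℂ M₀' =
      {1/2 + (Complex.I/2) * (Real.sqrt r : ℂ), 1/2 - (Complex.I/2) * (Real.sqrt r : ℂ)} := by
  have hs : (Real.sqrt r : ℂ) * (Real.sqrt r : ℂ) = r := by
    exact_mod_cast Real.mul_self_sqrt hr.le
  have hI := Complex.I_mul_I
  have hsq : M₀' * M₀' = (1 : ℂ) • M₀' + (-(1 + (r : ℂ)) / 4) • (1 : (X × X) →L[ℂ] (X × X)) := by
    refine ContinuousLinearMap.ext fun ⟨v, w⟩ => ?_
    simp only [mul_apply_eq_comp, add_apply,
      smul_apply, one_apply_eq_self, hM₀', Prod.smul_mk,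
      Prod.mk_add_mk, Prod.mk.injEq]
    constructor <;> module
  have hroot (m : ℂ) (hm : m * m = -(r : ℂ) / 4) : 1 / 2 + m ∈ spectrum ℂ M₀' := by
    obtain ⟨x, hx⟩ := exists_ne (0 : X)
    refine ContinuousLinearMap.mem_spectrum_of_apply_eq_smul (x := (x, m • x))
      (fun h => hx (congrArg Prod.fst h)) ?_
    rw [hM₀', Prod.smul_mk, Prod.mk.injEq]
    refine ⟨by module, ?_⟩
    rw [smul_smul, smul_smul, ← add_smul]
    congr 1
    linear_combination -hm
  ext z
  simp only [Set.mem_insert_iff, Set.mem_singleton_iff]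
  constructor
  · intro hz
    have hq := eq_zero_of_mem_spectrum_of_mul_self_eq hsq hz
    have hfac : (z - (1 / 2 + Complex.I / 2 * (Real.sqrt r : ℂ))) *
        (z - (1 / 2 - Complex.I / 2 * (Real.sqrt r : ℂ))) = 0 := by
      linear_combination hq + (1 / 4) * hs - (1 / 4) * (Real.sqrt r : ℂ) ^ 2 * hI
    exact (mul_eq_zero.mp hfac).imp sub_eq_zero.mp sub_eq_zero.mp
  · rintro (rfl | rfl)
    · refine hroot _ ?_
      linear_combination (1 / 4) * (Real.sqrt r : ℂ) ^ 2 * hI - (1 / 4) * hs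
    · rw [sub_eq_add_neg]
      refine hroot _ ?_
      linear_combination (1 / 4) * (Real.sqrt r : ℂ) ^ 2 * hI - (1 / 4) * hs
end

section
/- Assume the Calderón identities hold for both signs s ∈ {+, -}, that K⁺, K⁻, T⁺, T⁻ are compact operators, and that V⁺ - V⁻ and D⁺ - D⁻ are compact operators. Let C⁺ be the exterior Calderón preconditioner on X × Y, C⁺ (u, v) = (-(K⁺ u) + V⁺ v, D⁺ u + T⁺ v). Then the preconditioned operator C⁺ ∘ A differs by a compact operator from the block-diagonal scalar operator L (u, v) = ((1/4 + b/4) • u, (1/4 + a/4) • v); that is, C⁺ ∘ A - L is compact on X × Y. In particular, preconditioning the PMCHWT operator with only the exterior Calderón operator yields the two eigenvalue accumulation points 1/4 + ρ₊/(4ρ₋) and 1/4 + ρ₋/(4ρ₊) when a = ρ₋/ρ₊ and b = ρ₊/ρ₋. -/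
theorem IsCompactOperator.prodMk {M M₁ M₂ : Type*} [Zero M] [TopologicalSpace M]
    [TopologicalSpace M₁] [TopologicalSpace M₂] {f : M → M₁} {g : M → M₂}
    (hf : IsCompactOperator f) (hg : IsCompactOperator g) :
    IsCompactOperator fun x => (f x, g x) := by
  obtain ⟨A, hA, hfA⟩ := hf
  obtain ⟨B, hB, hgB⟩ := hg
  exact ⟨A ×ˢ B, hA.prod hB, Filter.mem_of_superset (Filter.inter_mem hfA hgB) fun _ hx => hx⟩

/-- Under the Calderón identities for both wavenumbers, compactness of
`K⁺, K⁻, T⁺, T⁻` and of `V⁺ - V⁻`, `D⁺ - D⁻`, preconditioning the PMCHWT operator `A`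
with the exterior Calderón operator `C⁺ (u, v) = (-(K⁺ u) + V⁺ v, D⁺ u + T⁺ v)` yields an
operator that differs by a compact operator from the block-diagonal scalar operator
`L (u, v) = ((1/4 + b/4) • u, (1/4 + a/4) • v)`. -/
theorem exterior_calderon_pmchwt_compact_perturbation
    {X Y : Type*} [NormedAddCommGroup X] [NormedSpace ℂ X] [CompleteSpace X]
    [NormedAddCommGroup Y] [NormedSpace ℂ Y] [CompleteSpace Y]
    (Kp Km : X →L[ℂ] X) (Vp Vm : Y →L[ℂ] X) (Dp Dm : X →L[ℂ] Y) (Tp Tm : Y →L[ℂ] Y)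
    (a b : ℂ)
    (hVDp : Vp.comp Dp = (1/4 : ℂ) • ContinuousLinearMap.id ℂ X - Kp.comp Kp)
    (hVDm : Vm.comp Dm = (1/4 : ℂ) • ContinuousLinearMap.id ℂ X - Km.comp Km)
    (hDVp : Dp.comp Vp = (1/4 : ℂ) • ContinuousLinearMap.id ℂ Y - Tp.comp Tp)
    (hDVm : Dm.comp Vm = (1/4 : ℂ) • ContinuousLinearMap.id ℂ Y - Tm.comp Tm)
    (hVTp : Vp.comp Tp = Kp.comp Vp)
    (hVTm : Vm.comp Tm = Km.comp Vm)
    (hTDp : Tp.comp Dp = Dp.comp Kp)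
    (hTDm : Tm.comp Dm = Dm.comp Km)
    (hKp : IsCompactOperator ⇑Kp) (hKm : IsCompactOperator ⇑Km)
    (hTp : IsCompactOperator ⇑Tp) (hTm : IsCompactOperator ⇑Tm)
    (hV : IsCompactOperator ⇑(Vp - Vm))
    (hD : IsCompactOperator ⇑(Dp - Dm))
    (A : (X × Y) →L[ℂ] (X × Y))
    (hA : ∀ (u : X) (v : Y),
      A (u, v) = (-(Kp u + Km u) + (Vp v + a • Vm v), (Dp u + b • Dm u) + (Tp v + Tm v)))
    (Cp : (X × Y) →L[ℂ] (X × Y))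
    (hCp : ∀ (u : X) (v : Y), Cp (u, v) = (-(Kp u) + Vp v, Dp u + Tp v))
    (L : (X × Y) →L[ℂ] (X × Y))
    (hL : ∀ (u : X) (v : Y), L (u, v) = ((1/4 + b/4 : ℂ) • u, (1/4 + a/4 : ℂ) • v)) :
    IsCompactOperator ⇑(Cp.comp A - L) := by
  have hfst : IsCompactOperator fun z : X × Y =>
      Kp ((Km - b • Kp) z.1 - (Vp + a • Vm) z.2) - b • Vp ((Dp - Dm) z.1)
        + Vp ((Tp + Tm) z.2) :=
    ((hKp.comp_clm ((Km - b • Kp).comp (.fst ℂ X Y) - (Vp + a • Vm).comp (.snd ℂ X Y))).sub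
      (((hD.clm_comp Vp).comp_clm (.fst ℂ X Y)).smul b)).add
      (((hTp.add hTm).clm_comp Vp).comp_clm (.snd ℂ X Y))
  have hsnd : IsCompactOperator fun z : X × Y =>
      Tp ((Dp + b • Dm) z.1 + (Tm - a • Tp) z.2) - a • Dp ((Vp - Vm) z.2)
        - Dp ((Kp + Km) z.1) :=
    ((hTp.comp_clm ((Dp + b • Dm).comp (.fst ℂ X Y) + (Tm - a • Tp).comp (.snd ℂ X Y))).sub
      (((hV.clm_comp Dp).comp_clm (.snd ℂ X Y)).smul a)).sub
      (((hKp.add hKm).clm_comp Dp).comp_clm (.fst ℂ X Y))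
  convert hfst.prodMk hsnd using 1
  funext ⟨u, v⟩
  have hVD : Vp (Dp u) = (1/4 : ℂ) • u - Kp (Kp u) := by
    simpa using DFunLike.congr_fun hVDp u
  have hDV : Dp (Vp v) = (1/4 : ℂ) • v - Tp (Tp v) := by
    simpa using DFunLike.congr_fun hDVp v
  rw [sub_apply, ContinuousLinearMap.comp_apply, hA, hCp, hL]
  ext
  · simp only [Prod.fst_sub, map_add, map_sub, map_neg, map_smul, add_apply,
      sub_apply, smul_apply, hVD]
    module
  · simp only [Prod.snd_sub, map_add, map_sub, map_neg, map_smul, add_apply,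
      sub_apply, smul_apply, hDV]
    module
end
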